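/- arXiv:1604.03379 — 4 statements merged into one kernel-verified Lean document; each statement's English description precedes it below -/
import Mathlib

section
/- Let Ξ = (ξ_{jk}) ∈ ℝ^{N×N} be a coupling matrix: ξ_{jk} ≥ 0 for j ≠ k, ξ_{jj} = −∑_{k≠j} ξ_{jk}, and Ξ irreducible. Let σ > 0 and set Ξ̃ = Ξ − diag(σ, 0, …, 0). Let p = (p¹,…,pᴺ) be a vector with all entries strictly positive satisfying pᵀΞ = 0, and let P = diag(p¹,…,pᴺ). Then the symmetric matrix PΞ̃ + Ξ̃ᵀP is negative definite. -/
open Matrix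

/-- The quadratic form of the symmetrization `diag(p) A + Aᵀ diag(p)`. -/
theorem dotProduct_diagonal_symmetrization_mulVec {n : Type*} [Fintype n] [DecidableEq n]
    (A : Matrix n n ℝ) (p v : n → ℝ) :
    v ⬝ᵥ ((Matrix.diagonal p * A + Aᵀ * Matrix.diagonal p) *ᵥ v) =
      2 * ∑ j, ∑ k, p j * A j k * (v j * v k) := by
  have hleft : v ⬝ᵥ ((Matrix.diagonal p * A) *ᵥ v) = ∑ j, ∑ k, p j * A j k * (v j * v k) := by
    simp only [dotProduct, mulVec, Matrix.diagonal_mul, Finset.mul_sum]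
    exact Finset.sum_congr rfl fun j _ => Finset.sum_congr rfl fun k _ => by ring
  have hright : v ⬝ᵥ ((Aᵀ * Matrix.diagonal p) *ᵥ v) = ∑ j, ∑ k, p j * A j k * (v j * v k) := by
    simp only [dotProduct, mulVec, Matrix.mul_diagonal, Matrix.transpose_apply, Finset.mul_sum]
    rw [Finset.sum_comm]
    exact Finset.sum_congr rfl fun j _ => Finset.sum_congr rfl fun k _ => by ring
  rw [Matrix.add_mulVec, dotProduct_add, hleft, hright, two_mul]

/-- If `A` has zero row sums and `p` is a left null vector of `A`, then the weighted quadratic form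
of `A` is a combination of squared differences. -/
theorem two_mul_weighted_form_eq_neg_sum_sq_sub {n : Type*} [Fintype n]
    (A : Matrix n n ℝ) (p v : n → ℝ) (hrow : ∀ j, ∑ k, A j k = 0)
    (hcol : ∀ k, ∑ j, p j * A j k = 0) :
    2 * ∑ j, ∑ k, p j * A j k * (v j * v k) =
      -∑ j, ∑ k, p j * A j k * (v j - v k) ^ 2 := by
  have hfst : ∑ j, ∑ k, p j * A j k * v j ^ 2 = 0 := by
    refine Finset.sum_eq_zero fun j _ => ?_
    rw [← Finset.sum_mul, ← Finset.mul_sum, hrow, mul_zero, zero_mul]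
  have hsnd : ∑ j, ∑ k, p j * A j k * v k ^ 2 = 0 := by
    rw [Finset.sum_comm]
    refine Finset.sum_eq_zero fun k _ => ?_
    rw [← Finset.sum_mul, hcol, zero_mul]
  have hexpand : ∑ j, ∑ k, p j * A j k * (v j - v k) ^ 2 =
      ∑ j, ∑ k, p j * A j k * v j ^ 2 + ∑ j, ∑ k, p j * A j k * v k ^ 2 -
        2 * ∑ j, ∑ k, p j * A j k * (v j * v k) := by
    simp only [Finset.mul_sum, ← Finset.sum_add_distrib, ← Finset.sum_sub_distrib]
    exact Finset.sum_congr rfl fun j _ => Finset.sum_congr rfl fun k _ => by ring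
  rw [hexpand, hfst, hsnd]
  ring

/-- Lemma 2: for a coupling matrix `Ξ` (nonnegative
off-diagonal entries, zero row sums, irreducible), a pinning gain `σ > 0`,
the pinned matrix `Ξ̃ = Ξ − diag(σ,0,…,0)`, and `P = diag p` built from a
strictly positive left null vector `p` of `Ξ`, the symmetric matrix
`PΞ̃ + Ξ̃ᵀP` is negative definite. -/
theorem pinned_matrix_negative_definite (N : ℕ)
    (Ξ : Matrix (Fin (N + 1)) (Fin (N + 1)) ℝ)
    (hoff : ∀ j k, j ≠ k → 0 ≤ Ξ j k)
    (hrow : ∀ j, Ξ j j = -∑ k ∈ Finset.univ.erase j, Ξ j k)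
    (hirr : ∀ S : Finset (Fin (N + 1)), S.Nonempty → S ≠ Finset.univ →
      ∃ j ∈ S, ∃ k, k ∉ S ∧ 0 < Ξ j k)
    (σ : ℝ) (hσ : 0 < σ)
    (Ξt : Matrix (Fin (N + 1)) (Fin (N + 1)) ℝ)
    (hΞt : Ξt = Ξ - Matrix.diagonal (fun j => if j = 0 then σ else 0))
    (p : Fin (N + 1) → ℝ) (hp : ∀ j, 0 < p j)
    (hpleft : ∀ k, ∑ j, p j * Ξ j k = 0) :
    (Matrix.diagonal p * Ξt + Ξtᵀ * Matrix.diagonal p).IsSymm ∧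
      ∀ v : Fin (N + 1) → ℝ, v ≠ 0 →
        v ⬝ᵥ ((Matrix.diagonal p * Ξt + Ξtᵀ * Matrix.diagonal p) *ᵥ v) < 0 := by
  refine ⟨?_, fun v hv => ?_⟩
  · simp [Matrix.IsSymm, Matrix.transpose_mul, add_comm]
  have hsum : ∀ j, ∑ k, Ξ j k = 0 := fun j => by
    rw [← Finset.add_sum_erase _ _ (Finset.mem_univ j), hrow j, neg_add_cancel]
  have hpin : ∑ j, ∑ k, p j * Ξt j k * (v j * v k) =
      ∑ j, ∑ k, p j * Ξ j k * (v j * v k) - p 0 * σ * v 0 ^ 2 := by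
    simp only [hΞt, Matrix.sub_apply, Matrix.diagonal_apply, mul_sub, sub_mul,
      Finset.sum_sub_distrib, mul_ite, ite_mul, mul_zero, zero_mul, Finset.sum_ite_eq,
      Finset.sum_ite_eq', Finset.mem_univ, if_true]
    ring
  rw [dotProduct_diagonal_symmetrization_mulVec, hpin, mul_sub,
    two_mul_weighted_form_eq_neg_sum_sq_sub Ξ p v hsum hpleft]
  have hterm : ∀ j k, 0 ≤ p j * Ξ j k * (v j - v k) ^ 2 := fun j k => by
    rcases eq_or_ne j k with rfl | hjk
    · simp
    · exact mul_nonneg (mul_nonneg (hp j).le (hoff j k hjk)) (sq_nonneg _)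
  have hinner : ∀ j, 0 ≤ ∑ k, p j * Ξ j k * (v j - v k) ^ 2 := fun j =>
    Finset.sum_nonneg fun k _ => hterm j k
  by_cases hv0 : v 0 = 0
  · obtain ⟨i, hi⟩ := Function.ne_iff.mp hv
    obtain ⟨j, hj, k, hk, hjk⟩ := hirr (Finset.univ.filter fun j => v j ≠ 0)
      ⟨i, by simpa using hi⟩
      (fun h => by simpa [hv0] using (Finset.ext_iff.mp h 0))
    have hj : v j ≠ 0 := by simpa using hj
    have hk : v k = 0 := by simpa using hk
    have hpos : 0 < p j * Ξ j k * (v j - v k) ^ 2 := by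
      have := hp j
      rw [hk, sub_zero]
      positivity
    have hsum_pos : 0 < ∑ j, ∑ k, p j * Ξ j k * (v j - v k) ^ 2 :=
      Finset.sum_pos' (fun j _ => hinner j) ⟨j, Finset.mem_univ j,
        Finset.sum_pos' (fun k _ => hterm j k) ⟨k, Finset.mem_univ k, hpos⟩⟩
    rw [hv0]
    linarith
  · have hsum_nonneg : 0 ≤ ∑ j, ∑ k, p j * Ξ j k * (v j - v k) ^ 2 :=
      Finset.sum_nonneg fun j _ => hinner j
    have hpos : 0 < p 0 * σ * v 0 ^ 2 := by
      have := hp 0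
      positivity
    linarith
end

section
/- Let 0 = t_0 < s_0 < t_1 < s_1 < t_2 < ⋯ with t_i → ∞, let τ̄ > 0, let τ : [0,∞) → [0, τ̄], and let β₁, β₂, β₃ be constants with β₁ > β₂ ≥ 0 and β := β₁ + β₃ > 0. Let ρ⋆ ∈ (0,1) satisfy (t_{i+1} − s_i)/(t_{i+1} − t_i) ≤ ρ⋆ for all i. Let λ > 0 be the unique positive solution of λ − β₁ + β₂e^{λτ̄} = 0 and suppose ε := λ − βρ⋆ > 0. If V : [−τ̄, ∞) → [0,∞) is continuous, differentiable on (0,∞), and satisfies V′(t) ≤ −β₁V(t) + β₂V(t − τ(t)) for all t ∈ [t_i, s_i] and V′(t) ≤ β₃V(t) + β₂V(t − τ(t)) for all t ∈ [s_i, t_{i+1}] (for every i = 0,1,2,…), then V(t) ≤ (sup_{−τ̄ ≤ κ ≤ 0} V(κ)) · e^{−εt} for all t ≥ 0. -/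
open Set Filter

/-- The derivative is nonnegative at a point where a function reaches a nonnegative value after
being nonpositive immediately to the left. -/
lemma HasDerivAt.nonneg_of_nonpos_left {h : ℝ → ℝ} {h' a x : ℝ} (hx : HasDerivAt h h' x)
    (hax : a < x) (hneg : ∀ t ∈ Ico a x, h t ≤ 0) (hpos : 0 ≤ h x) : 0 ≤ h' := by
  have hslope : Tendsto (slope h x) (nhdsWithin x (Iio x)) (nhds h') :=
    (hasDerivWithinAt_iff_tendsto_slope' (s := Iio x) (lt_irrefl x)).1 hx.hasDerivWithinAt
  refine ge_of_tendsto hslope ?_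
  filter_upwards [Ico_mem_nhdsLT hax] with t ht
  rw [slope_def_field]
  exact div_nonneg_of_nonpos (by linarith [hneg t ht]) (by linarith [ht.2])

/-- Growth estimate for a function whose derivative is controlled at the times where the function
attains its running maximum over `[l, t]`. -/
lemma le_mul_exp_of_deriv_le_at_running_max {W W' : ℝ → ℝ} {l a b K γ : ℝ} (hK : 0 ≤ K)
    (hγ : 0 ≤ γ) (hc : ContinuousOn W (Icc a b))
    (hd : ∀ t ∈ Ioc a b, HasDerivAt W (W' t) t)
    (hla : l ≤ a) (hpast : ∀ t ∈ Icc l a, W t ≤ K)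
    (hmax : ∀ t ∈ Ioc a b, (∀ s ∈ Icc l t, W s ≤ W t) → W' t ≤ γ * W t) :
    ∀ t ∈ Icc a b, W t ≤ K * Real.exp (γ * (t - a)) := by
  have hstrict : ∀ δ > 0, ∀ t ∈ Icc a b, W t < (K + δ) * Real.exp ((γ + δ) * (t - a)) := by
    intro δ hδ
    set B : ℝ → ℝ := fun t => (K + δ) * Real.exp ((γ + δ) * (t - a)) with hB
    have hBd : ∀ t, HasDerivAt B ((γ + δ) * B t) t := by
      intro t
      have h := ((((hasDerivAt_id t).sub_const a).const_mul (γ + δ)).exp).const_mul (K + δ)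
      refine h.congr_deriv ?_
      simp only [hB, id]
      ring
    have hBc : Continuous B := by fun_prop
    have hBpos : ∀ t, 0 < B t := fun t => mul_pos (by linarith) (Real.exp_pos _)
    have hBmono : Monotone B := by
      intro x y hxy
      simp only [hB]
      gcongr
    have hBa : B a = K + δ := by simp [hB]
    by_contra! hcon
    obtain ⟨u, hu, hWu⟩ := hcon
    have hclosed : IsClosed (Icc a b ∩ {t | B t ≤ W t}) := by
      have h := (hc.sub hBc.continuousOn).preimage_isClosed_of_isClosed isClosed_Icc
        (isClosed_Ici (a := (0 : ℝ)))
      convert h using 1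
      ext t
      simp
    obtain ⟨x, ⟨hxab, hxW⟩, hleast⟩ :=
      (isCompact_Icc.of_isClosed_subset hclosed inter_subset_left).exists_isLeast ⟨u, hu, hWu⟩
    have hxW : B x ≤ W x := hxW
    have hbefore : ∀ t ∈ Ico a x, W t < B t := by
      intro t ht
      by_contra! hle
      exact absurd (hleast ⟨⟨ht.1, ht.2.le.trans hxab.2⟩, hle⟩) (not_le.2 ht.2)
    have hax : a < x := by
      refine lt_of_le_of_ne hxab.1 fun hxa => ?_
      subst hxa
      linarith [hpast a ⟨hla, le_rfl⟩]
    have hxmem : x ∈ Ioc a b := ⟨hax, hxab.2⟩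
    have hrun : ∀ s ∈ Icc l x, W s ≤ W x := by
      intro s hs
      rcases le_or_gt s a with hsa | hsa
      · linarith [hpast s ⟨hs.1, hsa⟩, hBmono hax.le]
      · rcases hs.2.eq_or_lt with rfl | hsx
        · exact le_rfl
        · exact (hbefore s ⟨hsa.le, hsx⟩).le.trans ((hBmono hsx.le).trans hxW)
    have hWB : W x ≤ B x := by
      have hcl : x ∈ closure (Ico a x) := by
        rw [closure_Ico hax.ne]
        exact ⟨hax.le, le_rfl⟩
      have hsub : Ico a x ⊆ Icc a b := fun t ht => ⟨ht.1, ht.2.le.trans hxab.2⟩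
      exact ContinuousWithinAt.closure_le hcl ((hc x hxab).mono hsub)
        hBc.continuousWithinAt fun t ht => (hbefore t ht).le
    have hder := ((hd x hxmem).sub (hBd x)).nonneg_of_nonpos_left hax
      (fun t ht => sub_nonpos.2 (hbefore t ht).le) (sub_nonneg.2 hxW)
    have hW' := hmax x hxmem hrun
    rw [le_antisymm hWB hxW] at hW'
    nlinarith [mul_pos hδ (hBpos x)]
  intro t ht
  have hlim : Tendsto (fun δ : ℝ => (K + δ) * Real.exp ((γ + δ) * (t - a)))
      (nhdsWithin 0 (Ioi 0)) (nhds (K * Real.exp (γ * (t - a)))) := by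
    have h : Continuous fun δ : ℝ => (K + δ) * Real.exp ((γ + δ) * (t - a)) := by fun_prop
    simpa using (h.tendsto 0).mono_left nhdsWithin_le_nhds
  refine ge_of_tendsto hlim ?_
  filter_upwards [self_mem_nhdsWithin] with δ hδ
  exact (hstrict δ hδ t ht).le

/-- One span of a delayed differential inequality, for the weighted function
`exp (lam * t) * V t`. -/
lemma exp_mul_le_of_delay_deriv_le {V τ : ℝ → ℝ} {τb β₂ lam c γ a b K : ℝ} (hτb : 0 ≤ τb)
    (hτ : ∀ t, 0 ≤ t → τ t ∈ Icc 0 τb) (hβ₂ : 0 ≤ β₂) (hlam : 0 ≤ lam)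
    (hVc : ContinuousOn V (Ici (-τb))) (hVnn : ∀ t ∈ Ici (-τb), 0 ≤ V t)
    (hVd : ∀ t ∈ Ioi (0 : ℝ), DifferentiableAt ℝ V t)
    (hγ : 0 ≤ γ) (hγc : lam + c + β₂ * Real.exp (lam * τb) = γ) (ha : 0 ≤ a) (hK : 0 ≤ K)
    (hpast : ∀ t ∈ Icc (-τb) a, Real.exp (lam * t) * V t ≤ K)
    (hV : ∀ t ∈ Ioc a b, deriv V t ≤ c * V t + β₂ * V (t - τ t)) :
    ∀ t ∈ Icc a b, Real.exp (lam * t) * V t ≤ K * Real.exp (γ * (t - a)) := by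
  refine le_mul_exp_of_deriv_le_at_running_max (W := fun t => Real.exp (lam * t) * V t)
    (W' := fun t => Real.exp (lam * t) * (lam * V t + deriv V t)) hK hγ ?_ ?_
    (by linarith) hpast ?_
  · refine ContinuousOn.mul (by fun_prop) (hVc.mono fun t ht => ?_)
    exact (by linarith [ht.1] : -τb ≤ t)
  · intro t ht
    have h := (((hasDerivAt_id t).const_mul lam).exp).mul
      (hVd t (ha.trans_lt ht.1)).hasDerivAt
    refine h.congr_deriv ?_
    simp only [id]
    ring
  · intro t ht hrun
    have ht0 : 0 ≤ t := ha.trans ht.1.le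
    obtain ⟨hτ0, hτ1⟩ := hτ t ht0
    have hdelay := hrun (t - τ t) ⟨by linarith, by linarith⟩
    have hVt : 0 ≤ V t := hVnn t (by simp only [mem_Ici]; linarith)
    have hVdel : V (t - τ t) ≤ Real.exp (lam * τb) * V t := by
      have hexp : Real.exp (lam * (t - τ t)) * Real.exp (lam * τ t) = Real.exp (lam * t) := by
        rw [← Real.exp_add]
        ring_nf
      have h : V (t - τ t) ≤ Real.exp (lam * τ t) * V t := by
        refine le_of_mul_le_mul_left ?_ (Real.exp_pos (lam * (t - τ t)))
        rwa [← mul_assoc, hexp]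
      refine h.trans ?_
      gcongr
    have hbound : lam * V t + deriv V t ≤ γ * V t := by
      rw [← hγc]
      nlinarith [hV t ht, mul_le_mul_of_nonneg_left hVdel hβ₂]
    calc Real.exp (lam * t) * (lam * V t + deriv V t)
        ≤ Real.exp (lam * t) * (γ * V t) := by gcongr
      _ = γ * (Real.exp (lam * t) * V t) := by ring

/-- Lemma 3, Halanay-type estimate for aperiodically
intermittent control with time-varying delay: if the nonnegative continuous
function `V` satisfies a stabilizing differential inequality on the control
spans `[t_i, s_i]` and a destabilizing one on the rest spans `[s_i, t_{i+1}]`,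
then `V` decays exponentially with rate `ε = λ − βρ⋆`. -/
theorem halanay_aperiodic (ts ss : ℕ → ℝ) (hts0 : ts 0 = 0)
    (hcs : ∀ i, ts i < ss i) (hrs : ∀ i, ss i < ts (i + 1))
    (htlim : Tendsto ts atTop atTop)
    (τb : ℝ) (hτb : 0 < τb)
    (τ : ℝ → ℝ) (hτ : ∀ t, 0 ≤ t → τ t ∈ Icc 0 τb)
    (β₁ β₂ β₃ : ℝ) (hβ₂ : 0 ≤ β₂) (hβ₁₂ : β₂ < β₁) (hβ : 0 < β₁ + β₃)
    (ρs : ℝ) (hρs : ρs ∈ Ioo (0 : ℝ) 1)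
    (hρ : ∀ i, (ts (i + 1) - ss i) / (ts (i + 1) - ts i) ≤ ρs)
    (lam : ℝ) (hlam : 0 < lam)
    (hlameq : lam - β₁ + β₂ * Real.exp (lam * τb) = 0)
    (hε : 0 < lam - (β₁ + β₃) * ρs)
    (V : ℝ → ℝ) (hVc : ContinuousOn V (Ici (-τb)))
    (hVnn : ∀ t ∈ Ici (-τb), 0 ≤ V t)
    (hVd : ∀ t ∈ Ioi (0 : ℝ), DifferentiableAt ℝ V t)
    (hV₁ : ∀ i, ∀ t ∈ Icc (ts i) (ss i), 0 < t →
      deriv V t ≤ -β₁ * V t + β₂ * V (t - τ t))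
    (hV₂ : ∀ i, ∀ t ∈ Icc (ss i) (ts (i + 1)), 0 < t →
      deriv V t ≤ β₃ * V t + β₂ * V (t - τ t)) :
    ∀ t ≥ (0 : ℝ),
      V t ≤ sSup (V '' Icc (-τb) 0) * Real.exp (-(lam - (β₁ + β₃) * ρs) * t) := by
  set β := β₁ + β₃ with hβdef
  set M := sSup (V '' Icc (-τb) 0)
  have hVM : ∀ t ∈ Icc (-τb) 0, V t ≤ M := fun t ht =>
    le_csSup (isCompact_Icc.bddAbove_image (hVc.mono Icc_subset_Ici_self)) (mem_image_of_mem V ht)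
  have hM0 : 0 ≤ M :=
    (hVnn 0 (by simp [hτb.le])).trans (hVM 0 ⟨by linarith, le_rfl⟩)
  have hβρ : 0 ≤ β * ρs := mul_nonneg hβ.le hρs.1.le
  have hbound : ∀ i, 0 ≤ ts i ∧ ∀ t ∈ Icc (-τb) (ts i),
      Real.exp (lam * t) * V t ≤ M * Real.exp (β * ρs * max t 0) := by
    intro i
    induction i with
    | zero =>
      refine ⟨hts0.ge, fun t ht => ?_⟩
      rw [hts0] at ht
      rw [max_eq_right ht.2, mul_zero, Real.exp_zero, mul_one]
      have hexp : Real.exp (lam * t) ≤ 1 :=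
        Real.exp_le_one_iff.2 (mul_nonpos_of_nonneg_of_nonpos hlam.le ht.2)
      exact (mul_le_of_le_one_left (hVnn t ht.1) hexp).trans (hVM t ht)
    | succ i ih =>
      obtain ⟨hti, ih⟩ := ih
      have hcsi := hcs i
      have hrsi := hrs i
      set K := M * Real.exp (β * ρs * ts i) with hK
      have hK0 : 0 ≤ K := mul_nonneg hM0 (Real.exp_pos _).le
      have hpast : ∀ t ∈ Icc (-τb) (ts i), Real.exp (lam * t) * V t ≤ K := by
        intro t ht
        refine (ih t ht).trans ?_
        rw [hK]
        gcongr
        exact max_le ht.2 hti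
      have hcontrol : ∀ t ∈ Icc (ts i) (ss i), Real.exp (lam * t) * V t ≤ K := by
        have h := exp_mul_le_of_delay_deriv_le (c := -β₁) (γ := 0) hτb.le hτ hβ₂ hlam.le hVc hVnn
          hVd le_rfl (by linarith) hti hK0 hpast
          (fun t ht => hV₁ i t ⟨ht.1.le, ht.2⟩ (hti.trans_lt ht.1))
        simpa using h
      have hpast' : ∀ t ∈ Icc (-τb) (ss i), Real.exp (lam * t) * V t ≤ K := by
        intro t ht
        rcases le_total t (ts i) with h | h
        · exact hpast t ⟨ht.1, h⟩
        · exact hcontrol t ⟨h, ht.2⟩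
      have hrest := exp_mul_le_of_delay_deriv_le (c := β₃) (γ := β) hτb.le hτ hβ₂ hlam.le hVc hVnn
        hVd hβ.le (by linarith) (hti.trans hcsi.le) hK0 hpast'
        (fun t ht => hV₂ i t ⟨ht.1.le, ht.2⟩ ((hti.trans hcsi.le).trans_lt ht.1))
      refine ⟨by linarith, fun t ht => ?_⟩
      rcases le_total t (ts i) with h | h
      · exact ih t ⟨ht.1, h⟩
      rw [max_eq_left (hti.trans h)]
      rcases le_total t (ss i) with h' | h'
      · refine (hcontrol t ⟨h, h'⟩).trans ?_
        rw [hK]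
        gcongr
      · refine (hrest t ⟨h', ht.2⟩).trans ?_
        rw [hK, mul_assoc, ← Real.exp_add]
        have hratio := (div_le_iff₀ (by linarith)).1 (hρ i)
        have hwidth : t - ss i ≤ ρs * (t - ts i) := by
          nlinarith [mul_nonneg (sub_nonneg.2 hρs.2.le) (sub_nonneg.2 ht.2)]
        gcongr
        nlinarith [mul_le_mul_of_nonneg_left hwidth hβ.le]
  intro t ht
  obtain ⟨i, hi⟩ := (htlim.eventually_ge_atTop t).exists
  have h := (hbound i).2 t ⟨by linarith, hi⟩
  rw [max_eq_left ht] at h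
  refine le_of_mul_le_mul_left (h.trans_eq ?_) (Real.exp_pos (lam * t))
  rw [mul_left_comm, ← Real.exp_add]
  ring_nf
end

section
/- Let 0 = t_0 < s_0 < t_1 < s_1 < ⋯ with t_i → ∞, and suppose there exist 0 < θ < ω < ∞ with inf_i (s_i − t_i) = θ and sup_i (t_{i+1} − t_i) = ω. Let τ̄ > 0 satisfy τ̄ < inf_i (s_i − t_i), and let τ : [0,∞) → [0, τ̄]. Let M : ℝ × ℝ → ℝ be continuous with M(0,0) = 0 and suppose there exist L₁ > 0, L₂ > 0 such that V(t)·M(V(t), V(t − τ(t))) ≤ L₁V(t)² + L₂V(t − τ(t))² for all t ≥ 0. Let ψ > 0 and let Ψ : [0,∞) → [0,∞) satisfy: Ψ(0) = 0; Ψ(t) = 0 for t ∈ (s_i, t_{i+1}); Ψ(t_{i+1}) = Ψ(s_i); and on each [t_i, s_i], Ψ is differentiable with Ψ′(t) = ψ · max_{−τ̄ ≤ ς ≤ 0} V(t + ς)². If V : [−τ̄, ∞) → [0,∞) is continuous, differentiable on (0,∞), and satisfies V′(t) = M(V(t), V(t − τ(t))) − Ψ(t)V(t) for all t > 0, then lim_{t→∞}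 V(t) = 0. -/
open Set Filter

/-- If a function `f` starts strictly below `B` and, at every first contact with `B`, has a smaller
derivative than `B`, then it stays strictly below `B`. -/
theorem lt_of_deriv_lt_at_first_contact {f B f' B' : ℝ → ℝ} {a b : ℝ}
    (hf : ContinuousOn f (Icc a b)) (hB : ContinuousOn B (Icc a b)) (ha : f a < B a)
    (hf' : ∀ x ∈ Ioc a b, HasDerivAt f (f' x) x) (hB' : ∀ x ∈ Ioc a b, HasDerivAt B (B' x) x)
    (hlt : ∀ x ∈ Ioc a b, (∀ y ∈ Ico a x, f y < B y) → f x = B x → f' x < B' x) :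
    ∀ x ∈ Icc a b, f x < B x := by
  by_contra! hne
  obtain ⟨z, hz, hBz⟩ := hne
  have hclosed : IsClosed {x ∈ Icc a b | B x ≤ f x} :=
    isClosed_Icc.isClosed_le hB hf
  have hcompact : IsCompact {x ∈ Icc a b | B x ≤ f x} :=
    isCompact_Icc.of_isClosed_subset hclosed fun x hx => hx.1
  obtain ⟨x, ⟨hx, hBx⟩, hmin⟩ := hcompact.exists_isLeast ⟨z, hz, hBz⟩
  have hax : a < x := lt_of_le_of_ne hx.1 fun h => by subst h; linarith
  have hbelow : ∀ y ∈ Ico a x, f y < B y := fun y hy => by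
    by_contra! h
    exact absurd (hmin ⟨⟨hy.1, hy.2.le.trans hx.2⟩, h⟩) (not_le.2 hy.2)
  have hxab : x ∈ Ioc a b := ⟨hax, hx.2⟩
  have hd : HasDerivAt (fun y => f y - B y) (f' x - B' x) x := (hf' x hxab).sub (hB' x hxab)
  have hev : ∀ᶠ y in nhdsWithin x (Iio x), f y - B y < 0 := by
    filter_upwards [Ioo_mem_nhdsLT hax] with y hy
    linarith [hbelow y ⟨hy.1.le, hy.2⟩]
  have hle : f x - B x ≤ 0 :=
    le_of_tendsto (hd.continuousAt.tendsto.mono_left nhdsWithin_le_nhds)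
      (hev.mono fun y hy => hy.le)
  have heq : f x = B x := by linarith
  have hneg := hlt x hxab hbelow heq
  have hslope := (hasDerivAt_iff_tendsto_slope.1 hd).mono_left
    (nhdsWithin_mono x (show Iio x ⊆ {x}ᶜ from fun _ hy => ne_of_lt hy))
  have hge : 0 ≤ f' x - B' x := by
    refine ge_of_tendsto hslope ?_
    filter_upwards [hev, self_mem_nhdsWithin] with y hy hyx
    rw [slope_def_field]
    exact div_nonneg_of_nonpos (by linarith) (by linarith [show y < x from hyx])
  linarith

/-- A nonnegative solution `W` of the delay differential inequality
`W'(t) ≤ α W(t) + β W(t - τ(t)) - g(t) W(t)` for `t > 0`, with nonnegative gain `g`. -/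
structure IsDelaySubsolution (α β r : ℝ) (τ g W : ℝ → ℝ) : Prop where
  continuousOn : ContinuousOn W (Ici (-r))
  nonneg : ∀ t, -r ≤ t → 0 ≤ W t
  delay_mem : ∀ t, 0 ≤ t → τ t ∈ Icc 0 r
  gain_nonneg : ∀ t, 0 ≤ t → 0 ≤ g t
  differentiableAt : ∀ t, 0 < t → DifferentiableAt ℝ W t
  deriv_le : ∀ t, 0 < t → deriv W t ≤ α * W t + β * W (t - τ t) - g t * W t

namespace IsDelaySubsolution

variable {α β r : ℝ} {τ g W : ℝ → ℝ} {a b A : ℝ}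

theorem lt_of_barrier (h : IsDelaySubsolution α β r τ g W) (ha : 0 ≤ a) (hr : 0 ≤ r)
    {B B' : ℝ → ℝ} (hB : ∀ x, HasDerivAt B (B' x) x) (hWa : W a < B a)
    (hlt : ∀ x ∈ Ioc a b, (∀ y ∈ Ico a x, W y < B y) → W x = B x →
      α * W x + β * W (x - τ x) - g x * W x < B' x) :
    ∀ x ∈ Icc a b, W x < B x := by
  refine lt_of_deriv_lt_at_first_contact (f' := deriv W) (B' := B')
    (h.continuousOn.mono fun x hx => ?_) (fun x _ => (hB x).continuousAt.continuousWithinAt) hWa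
    (fun x hx => (h.differentiableAt x (ha.trans_lt hx.1)).hasDerivAt) (fun x _ => hB x)
    fun x hx hy heq => (h.deriv_le x (ha.trans_lt hx.1)).trans_lt (hlt x hx hy heq)
  exact mem_Ici.2 (by linarith [hx.1])

theorem pos_of_history_lt (h : IsDelaySubsolution α β r τ g W) (ha : 0 ≤ a) (hr : 0 ≤ r)
    (hA : ∀ y ∈ Icc (a - r) a, W y < A) : 0 < A :=
  (h.nonneg a (by linarith)).trans_lt (hA a ⟨by linarith, le_rfl⟩)

/-- Growth is at most exponential, whatever the gain. -/
theorem lt_mul_exp (h : IsDelaySubsolution α β r τ g W) (ha : 0 ≤ a) (hr : 0 ≤ r)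
    (hα : 0 ≤ α) (hβ : 0 ≤ β) (hA : ∀ y ∈ Icc (a - r) a, W y < A) {x : ℝ} (hx : a ≤ x) :
    W x < A * Real.exp ((α + β + 1) * (x - a)) := by
  have hApos := h.pos_of_history_lt ha hr hA
  have hmono : ∀ {u v : ℝ}, u ≤ v →
      A * Real.exp ((α + β + 1) * (u - a)) ≤ A * Real.exp ((α + β + 1) * (v - a)) := by
    intro u v huv
    gcongr
  refine h.lt_of_barrier (b := x) ha hr (B := fun y => A * Real.exp ((α + β + 1) * (y - a)))
    (B' := fun y => A * (Real.exp ((α + β + 1) * (y - a)) * ((α + β + 1) * 1)))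
    (fun y => (((((hasDerivAt_id y).sub_const a).const_mul (α + β + 1)).exp).const_mul A)) ?_ ?_
    x ⟨hx, le_rfl⟩
  · simpa using hA a ⟨by linarith, le_rfl⟩
  · intro y hy hlt heq
    have hy0 : 0 ≤ y := ha.trans hy.1.le
    obtain ⟨hτ0, hτr⟩ := h.delay_mem y hy0
    have hdelay : W (y - τ y) ≤ W y := by
      rcases le_or_gt (y - τ y) a with hya | hya
      · have h1 := hA (y - τ y) ⟨by linarith [hy.1], hya⟩
        have h2 := hmono hy.1.le
        simp only [sub_self, mul_zero, Real.exp_zero, mul_one] at h2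
        linarith
      · rcases hτ0.eq_or_lt with h0 | h0
        · rw [← h0, sub_zero]
        · have h1 := hlt (y - τ y) ⟨hya.le, by linarith⟩
          have h2 := hmono (show y - τ y ≤ y by linarith)
          linarith
    have hWy : 0 < W y := by rw [heq]; positivity
    have h3 := mul_le_mul_of_nonneg_left hdelay hβ
    have h4 := mul_nonneg (h.gain_nonneg y hy0) hWy.le
    have h5 : A * (Real.exp ((α + β + 1) * (y - a)) * ((α + β + 1) * 1)) =
      (α + β + 1) * W y := by rw [heq]; ring
    rw [h5]
    linarith

/-- Under a gain exceeding `α + β`, a bound on the history is preserved. -/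
theorem lt_of_gain_gt (h : IsDelaySubsolution α β r τ g W) (ha : 0 ≤ a) (hr : 0 ≤ r)
    (hβ : 0 ≤ β) (hA : ∀ y ∈ Icc (a - r) a, W y < A)
    (hg : ∀ y ∈ Icc a b, α + β < g y) : ∀ x ∈ Icc (a - r) b, W x < A := by
  have hApos := h.pos_of_history_lt ha hr hA
  intro x hx
  rcases le_or_gt x a with hxa | hxa
  · exact hA x ⟨hx.1, hxa⟩
  refine h.lt_of_barrier (b := b) ha hr (B := fun _ => A) (B' := fun _ => 0)
    (fun y => hasDerivAt_const y A) (hA a ⟨by linarith, le_rfl⟩) ?_ x ⟨hxa.le, hx.2⟩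
  intro y hy hlt heq
  obtain ⟨hτ0, hτr⟩ := h.delay_mem y (ha.trans hy.1.le)
  have hdelay : W (y - τ y) ≤ A := by
    rcases le_or_gt (y - τ y) a with hya | hya
    · exact (hA (y - τ y) ⟨by linarith [hy.1], hya⟩).le
    · rcases hτ0.eq_or_lt with h0 | h0
      · rw [← h0, sub_zero, heq]
      · exact (hlt (y - τ y) ⟨hya.le, by linarith⟩).le
  have h3 := mul_le_mul_of_nonneg_left hdelay hβ
  have h4 := mul_lt_mul_of_pos_right (hg y ⟨hy.1.le, hy.2⟩) hApos
  rw [heq]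
  linarith

/-- Under a large gain, the solution decays exponentially up to a small remainder. -/
theorem lt_mul_exp_neg_add (h : IsDelaySubsolution α β r τ g W) (ha : 0 ≤ a) (hr : 0 ≤ r)
    (hβ : 0 < β) (hA : ∀ y ∈ Icc (a - r) a, W y < A) {c : ℝ} (hc : β < c)
    (hg : ∀ y ∈ Icc a b, α + 2 * c ≤ g y) :
    ∀ x ∈ Icc a b, W x < A * (Real.exp (-c * (x - a)) + β / c) := by
  have hApos := h.pos_of_history_lt ha hr hA
  have hc0 : 0 < c := hβ.trans hc
  have hbound := h.lt_of_gain_gt ha hr hβ.le hA fun y hy => by linarith [hg y hy]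
  refine h.lt_of_barrier (b := b) ha hr (B := fun y => A * (Real.exp (-c * (y - a)) + β / c))
    (B' := fun y => A * (Real.exp (-c * (y - a)) * (-c * 1)))
    (fun y => (((((hasDerivAt_id y).sub_const a).const_mul (-c)).exp).add_const (β / c)).const_mul A)
    ?_ ?_
  · have h1 := hA a ⟨by linarith, le_rfl⟩
    have h2 : 0 < A * (β / c) := by positivity
    simp only [sub_self, mul_zero, Real.exp_zero]
    linarith
  · intro y hy hlt heq
    obtain ⟨hτ0, hτr⟩ := h.delay_mem y (ha.trans hy.1.le)
    have hdelay := hbound (y - τ y) ⟨by linarith [hy.1], by linarith [hy.2]⟩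
    have hWy : 0 < W y := by rw [heq]; positivity
    have h3 := mul_lt_mul_of_pos_left hdelay hβ
    have h4 := mul_le_mul_of_nonneg_right (hg y ⟨hy.1.le, hy.2⟩) hWy.le
    have h5 : A * (Real.exp (-c * (y - a)) * (-c * 1)) = β * A - c * W y := by
      rw [heq]; field_simp; ring
    rw [h5]
    linarith [mul_pos hc0 hWy]

/-- Over a control span with a large gain followed by an arbitrary rest span, the history is
contracted. -/
theorem lt_of_control_then_rest (h : IsDelaySubsolution α β r τ g W) (ha : 0 ≤ a) (hr : 0 ≤ r)
    (hα : 0 ≤ α) (hβ : 0 < β) (hA : ∀ y ∈ Icc (a - r) a, W y < A) {c e δ ω : ℝ} (hc : β < c)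
    (hδ : 0 ≤ δ) (hab : r + δ ≤ b - a) (hbe : b ≤ e) (hea : e - b ≤ ω)
    (hg : ∀ y ∈ Icc a b, α + 2 * c ≤ g y) :
    ∀ x ∈ Icc (e - r) e,
      W x < A * (Real.exp (-c * δ) + β / c) * Real.exp ((α + β + 1) * ω) := by
  have hApos := h.pos_of_history_lt ha hr hA
  have hc0 : 0 < c := hβ.trans hc
  have hend : ∀ y ∈ Icc (b - r) b, W y < A * (Real.exp (-c * δ) + β / c) := by
    intro y hy
    refine (h.lt_mul_exp_neg_add ha hr hβ hA hc hg y ⟨by linarith [hy.1], hy.2⟩).trans_le ?_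
    have h1 : -c * (y - a) ≤ -c * δ := by nlinarith [hy.1]
    gcongr
  intro x hx
  rcases le_or_gt x b with hxb | hxb
  · refine (hend x ⟨by linarith [hx.1], hxb⟩).trans_le (le_mul_of_one_le_right (by positivity) ?_)
    exact Real.one_le_exp (mul_nonneg (by linarith) (by linarith))
  · refine (h.lt_mul_exp (by linarith) hr hα hβ.le hend hxb.le).trans_le ?_
    have h1 : x - b ≤ ω := by linarith [hx.2]
    gcongr

end IsDelaySubsolution

/-- Every point beyond `u N` lies in some `[u i, u (i + 1))` with `N ≤ i`. -/
theorem exists_mem_Ico_of_tendsto_atTop {u : ℕ → ℝ} (hu : Tendsto u atTop atTop) {N : ℕ} {t : ℝ}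
    (ht : u N ≤ t) : ∃ i, N ≤ i ∧ t ∈ Ico (u i) (u (i + 1)) := by
  by_contra! hne
  have hall : ∀ i, N ≤ i → u i ≤ t := fun i hi => by
    induction i, hi using Nat.le_induction with
    | base => exact ht
    | succ k hk ih =>
      by_contra! hlt
      exact hne k hk ⟨ih, hlt⟩
  obtain ⟨i, hi, hlt⟩ := ((eventually_ge_atTop N).and (hu.eventually_gt_atTop t)).exists
  linarith [hall i hi]

namespace IsDelaySubsolution

variable {α β r : ℝ} {τ g W : ℝ → ℝ}

/-- If the history is eventually small at some time of each span, and spans are bounded, then the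
solution tends to zero. -/
theorem tendsto_zero (h : IsDelaySubsolution α β r τ g W) (hr : 0 ≤ r) (hα : 0 ≤ α) (hβ : 0 ≤ β)
    {u : ℕ → ℝ} (hu : Tendsto u atTop atTop) (hu0 : ∀ i, 0 ≤ u i) {ω : ℝ}
    (hω : ∀ i, u (i + 1) - u i ≤ ω)
    (hsmall : ∀ ε > 0, ∀ᶠ i in atTop, ∃ a ∈ Icc (u i) (u (i + 1)),
      ∀ y ∈ Icc (a - r) a, W y < ε) :
    Tendsto W atTop (nhds 0) := by
  rw [Metric.tendsto_atTop]
  intro ε hε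
  obtain ⟨N, hN⟩ := eventually_atTop.1
    (hsmall (ε / Real.exp ((α + β + 1) * (2 * ω))) (by positivity))
  refine ⟨u (N + 1), fun t ht => ?_⟩
  obtain ⟨i, hi, hti⟩ := exists_mem_Ico_of_tendsto_atTop hu ht
  obtain ⟨j, rfl⟩ : ∃ j, i = j + 1 := ⟨i - 1, by omega⟩
  obtain ⟨a, haj, ha⟩ := hN j (by omega)
  have ht0 := (hu0 _).trans hti.1
  rw [Real.dist_eq, sub_zero, abs_of_nonneg (h.nonneg t (by linarith))]
  refine (h.lt_mul_exp ((hu0 j).trans haj.1) hr hα hβ ha (haj.2.trans hti.1)).trans_le ?_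
  rw [div_mul_eq_mul_div, div_le_iff₀ (Real.exp_pos _)]
  have h1 : t - a ≤ 2 * ω := by linarith [hω j, hω (j + 1), hti.2, haj.1]
  gcongr

theorem exists_history_lt (h : IsDelaySubsolution α β r τ g W) {a : ℝ} (ha : 0 ≤ a) :
    ∃ A, 0 < A ∧ ∀ y ∈ Icc (a - r) a, W y < A := by
  obtain ⟨C, hC⟩ := (isCompact_Icc (a := a - r) (b := a)).bddAbove_image
    (h.continuousOn.mono fun x hx => mem_Ici.2 (by linarith [hx.1]))
  refine ⟨max C 0 + 1, by positivity, fun y hy => ?_⟩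
  linarith [hC (mem_image_of_mem W hy), le_max_left C 0]

/-- If the gain on control spans tends to infinity, the history at the start of the spans tends
to zero. -/
theorem eventually_history_lt_of_gain_tendsto (h : IsDelaySubsolution α β r τ g W) (hr : 0 ≤ r)
    (hα : 0 ≤ α) (hβ : 0 < β) {u v : ℕ → ℝ} (hu0 : ∀ i, 0 ≤ u i) (hvu : ∀ i, v i ≤ u (i + 1))
    {θ ω : ℝ} (hrθ : r < θ) (hθ : ∀ i, θ ≤ v i - u i) (hω : ∀ i, u (i + 1) - u i ≤ ω)
    (hg : ∀ G, ∀ᶠ i in atTop, ∀ y ∈ Icc (u i) (v i), G ≤ g y) {ε : ℝ} (hε : 0 < ε) :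
    ∀ᶠ i in atTop, ∀ y ∈ Icc (u i - r) (u i), W y < ε := by
  have hlim : Tendsto (fun c : ℝ => (Real.exp (-c * (θ - r)) + β / c) *
      Real.exp ((α + β + 1) * ω)) atTop (nhds 0) := by
    have h1 : Tendsto (fun c : ℝ => Real.exp (-c * (θ - r))) atTop (nhds 0) := by
      refine Real.tendsto_exp_atBot.comp ?_
      exact tendsto_neg_atTop_atBot.atBot_mul_const (by linarith)
    simpa using (h1.add (tendsto_const_nhds.div_atTop tendsto_id)).mul_const
      (Real.exp ((α + β + 1) * ω))
  obtain ⟨c, hcβ, hc⟩ := ((eventually_gt_atTop β).and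
    (hlim.eventually_lt_const (show (0 : ℝ) < 1 / 2 by norm_num))).exists
  obtain ⟨N, hN⟩ := eventually_atTop.1 (hg (α + 2 * c))
  obtain ⟨A, hA0, hA⟩ := h.exists_history_lt (hu0 N)
  have hgeom : ∀ n, ∀ y ∈ Icc (u (N + n) - r) (u (N + n)), W y < A * (1 / 2) ^ n := by
    intro n
    induction n with
    | zero => simpa using hA
    | succ n ih =>
      intro y hy
      have h1 := h.lt_of_control_then_rest (hu0 (N + n)) hr hα hβ ih hcβ
        (δ := θ - r) (ω := ω) (b := v (N + n)) (by linarith) (by linarith [hθ (N + n)])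
        (hvu (N + n)) (by linarith [hω (N + n), hθ (N + n)]) (hN _ (by omega)) y hy
      refine h1.trans_le ?_
      rw [mul_assoc, pow_succ, ← mul_assoc A]
      gcongr
  have hto : Tendsto (fun n : ℕ => A * (1 / 2 : ℝ) ^ n) atTop (nhds 0) := by
    simpa using (tendsto_pow_atTop_nhds_zero_of_lt_one (by norm_num)
      (by norm_num : (1 / 2 : ℝ) < 1)).const_mul A
  obtain ⟨K, hK⟩ := eventually_atTop.1 (hto.eventually_lt_const hε)
  filter_upwards [eventually_ge_atTop (N + K)] with i hi y hy
  obtain ⟨n, rfl⟩ : ∃ n, i = N + n := ⟨i - N, by omega⟩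
  exact (hgeom n y hy).trans (hK n (by omega))

end IsDelaySubsolution

/-- Lemma 4, convergence under the adaptive aperiodically
intermittent feedback gain: if the delay bound `τ̄` is smaller than the
infimum `θ` of the control span widths, the adaptive gain `Ψ` grows during
control spans according to the delayed history of `V` and is switched off
during rest spans, then `V(t) → 0` as `t → ∞`. -/
theorem adaptive_aperiodic_convergence (ts ss : ℕ → ℝ) (hts0 : ts 0 = 0)
    (hcs : ∀ i, ts i < ss i) (hrs : ∀ i, ss i < ts (i + 1))
    (htlim : Tendsto ts atTop atTop)
    (θ ω : ℝ) (hθ : 0 < θ) (hθω : θ < ω)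
    (hinf : (⨅ i, (ss i - ts i)) = θ) (hsup : (⨆ i, (ts (i + 1) - ts i)) = ω)
    (τb : ℝ) (hτb : 0 < τb) (hτθ : τb < θ)
    (τ : ℝ → ℝ) (hτ : ∀ t, 0 ≤ t → τ t ∈ Icc 0 τb)
    (M : ℝ → ℝ → ℝ) (hMc : Continuous fun q : ℝ × ℝ => M q.1 q.2)
    (hM0 : M 0 0 = 0)
    (L₁ L₂ : ℝ) (hL₁ : 0 < L₁) (hL₂ : 0 < L₂)
    (V : ℝ → ℝ) (hVc : ContinuousOn V (Ici (-τb)))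
    (hVnn : ∀ t ∈ Ici (-τb), 0 ≤ V t)
    (hVM : ∀ t ≥ (0 : ℝ), V t * M (V t) (V (t - τ t)) ≤
      L₁ * V t ^ 2 + L₂ * V (t - τ t) ^ 2)
    (ψ : ℝ) (hψ : 0 < ψ)
    (Ψ : ℝ → ℝ) (hΨnn : ∀ t ≥ (0 : ℝ), 0 ≤ Ψ t) (hΨ0 : Ψ 0 = 0)
    (hΨrest : ∀ i, ∀ t ∈ Ioo (ss i) (ts (i + 1)), Ψ t = 0)
    (hΨjump : ∀ i, Ψ (ts (i + 1)) = Ψ (ss i))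
    (hΨd : ∀ i, ∀ t ∈ Icc (ts i) (ss i),
      HasDerivWithinAt Ψ (ψ * sSup ((fun ς => (V (t + ς)) ^ 2) '' Icc (-τb) 0))
        (Icc (ts i) (ss i)) t)
    (hVd : ∀ t ∈ Ioi (0 : ℝ), DifferentiableAt ℝ V t)
    (hVeq : ∀ t ∈ Ioi (0 : ℝ), deriv V t = M (V t) (V (t - τ t)) - Ψ t * V t) :
    Tendsto V atTop (nhds 0) := by
  have hθi : ∀ i, θ ≤ ss i - ts i := fun i => by
    rw [← hinf]
    exact ciInf_le ⟨0, by rintro _ ⟨j, rfl⟩; exact sub_nonneg.2 (hcs j).le⟩ i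
  have hωi : ∀ i, ts (i + 1) - ts i ≤ ω := fun i => by
    rw [← hsup]
    refine le_ciSup (f := fun i => ts (i + 1) - ts i) ?_ i
    by_contra hbdd
    rw [Real.iSup_of_not_bddAbove hbdd] at hsup
    linarith
  have htmono : Monotone ts := monotone_nat_of_le_succ fun i => ((hcs i).trans (hrs i)).le
  have ht0 : ∀ i, 0 ≤ ts i := fun i => hts0 ▸ htmono (Nat.zero_le i)
  have hW : IsDelaySubsolution (2 * L₁) (2 * L₂) τb τ (fun t => 2 * Ψ t) (fun t => V t ^ 2) :=
    { continuousOn := hVc.pow 2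
      nonneg := fun t _ => sq_nonneg _
      delay_mem := hτ
      gain_nonneg := fun t ht => mul_nonneg zero_le_two (hΨnn t ht)
      differentiableAt := fun t ht => (hVd t ht).pow 2
      deriv_le := fun t ht => by
        have hd : HasDerivAt (fun t => V t ^ 2) (2 * V t * deriv V t) t := by
          simpa using (hVd t ht).hasDerivAt.fun_pow 2
        rw [hd.deriv, hVeq t ht]
        linear_combination 2 * hVM t (le_of_lt ht) }
  have hΨ'nn : ∀ t, 0 ≤ ψ * sSup ((fun ς => (V (t + ς)) ^ 2) '' Icc (-τb) 0) := fun t =>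
    mul_nonneg hψ.le (Real.sSup_nonneg (by rintro _ ⟨ς, -, rfl⟩; positivity))
  have hΨspan : ∀ i, MonotoneOn Ψ (Icc (ts i) (ss i)) := fun i =>
    monotoneOn_of_hasDerivWithinAt_nonneg (convex_Icc _ _)
      (fun t ht => (hΨd i t ht).continuousWithinAt)
      (fun t ht => (hΨd i t (interior_subset ht)).mono interior_subset) fun t _ => hΨ'nn t
  have hPmono : Monotone fun i => Ψ (ts i) := monotone_nat_of_le_succ fun i => by
    rw [hΨjump]
    exact hΨspan i (left_mem_Icc.2 (hcs i).le) (right_mem_Icc.2 (hcs i).le) (hcs i).le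
  have hWlim : Tendsto (fun t => V t ^ 2) atTop (nhds 0) := by
    refine hW.tendsto_zero hτb.le (by positivity) (by positivity) htlim ht0 hωi fun ε hε => ?_
    rcases tendsto_atTop_of_monotone hPmono with hP | ⟨l, hP⟩
    · have hgain : ∀ G, ∀ᶠ i in atTop, ∀ y ∈ Icc (ts i) (ss i), G ≤ 2 * Ψ y := fun G => by
        filter_upwards [hP.eventually_ge_atTop (G / 2)] with i hi y hy
        linarith [hΨspan i (left_mem_Icc.2 (hcs i).le) hy hy.1]
      filter_upwards [hW.eventually_history_lt_of_gain_tendsto hτb.le (by positivity)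
        (by positivity) ht0 (fun i => (hrs i).le) hτθ hθi hωi hgain hε] with i hi
      exact ⟨ts i, left_mem_Icc.2 (htmono i.le_succ), hi⟩
    · have hdiff : Tendsto (fun i => Ψ (ts (i + 1)) - Ψ (ts i)) atTop (nhds 0) := by
        simpa using ((tendsto_add_atTop_iff_nat 1).2 hP).sub hP
      filter_upwards [hdiff.eventually_lt_const (show 0 < ψ * ε * θ by positivity)] with i hi
      obtain ⟨a, ha, hslope⟩ := exists_hasDerivAt_eq_slope Ψ
        (fun t => ψ * sSup ((fun ς => (V (t + ς)) ^ 2) '' Icc (-τb) 0)) (hcs i)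
        (fun t ht => (hΨd i t ht).continuousWithinAt)
        fun t ht => (hΨd i t (Ioo_subset_Icc_self ht)).hasDerivAt (Icc_mem_nhds ht.1 ht.2)
      refine ⟨a, ⟨ha.1.le, (ha.2.trans (hrs i)).le⟩, fun y hy => ?_⟩
      have ha0 : 0 ≤ a := (ht0 i).trans ha.1.le
      have hbdd : BddAbove ((fun ς => (V (a + ς)) ^ 2) '' Icc (-τb) 0) := by
        refine isCompact_Icc.bddAbove_image (ContinuousOn.pow (hVc.comp (by fun_prop) ?_) 2)
        exact fun ς hς => mem_Ici.2 (by linarith [hς.1])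
      have hy_le := le_csSup hbdd
        (mem_image_of_mem _ (show y - a ∈ Icc (-τb) 0 from
          ⟨by linarith [hy.1], by linarith [hy.2]⟩))
      simp only [add_sub_cancel] at hy_le
      refine hy_le.trans_lt ?_
      rw [eq_div_iff (by linarith [hcs i]), ← hΨjump] at hslope
      have h1 := mul_le_mul_of_nonneg_left (hθi i) (hΨ'nn a)
      have h2 : (ψ * sSup ((fun ς => (V (a + ς)) ^ 2) '' Icc (-τb) 0)) * θ < ψ * ε * θ := by
        linarith
      exact lt_of_mul_lt_mul_left (lt_of_mul_lt_mul_right h2 hθ.le) hψ.le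
  have hsqrt := hWlim.sqrt
  rw [Real.sqrt_zero] at hsqrt
  refine hsqrt.congr' ?_
  filter_upwards [eventually_ge_atTop 0] with t ht
  exact Real.sqrt_sq (hVnn t (mem_Ici.2 (by linarith)))
end

section
/- Let Ω = ∏_{r=1}^m (−l_r, l_r) ⊂ ℝ^m with l_r > 0, let e : Ω̄ → ℝ^{Nn} be continuously differentiable on Ω̄ with e(x) = 0 for all x ∈ ∂Ω, let S ∈ ℝ^{N×N} be symmetric with λ_max(S) ≤ 0, and let Γ = diag(γ_1,…,γ_n) with γ_k > 0. Then ∑_{r=1}^m ∫_Ω (∂e/∂x_r(x))ᵀ (S ⊗ Γ) (∂e/∂x_r(x)) dx ≤ (min_{k=1,…,n} γ_k) · λ_max(S) · (∑_{r=1}^m 1/l_r²) · ∫_Ω ‖e(x)‖² dx. -/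
open MeasureTheory Set Matrix Kronecker

/-- The partial derivative `∂u/∂x_r` of a scalar field on `ℝ^m`. -/
noncomputable def par {m : ℕ} (u : EuclideanSpace ℝ (Fin m) → ℝ) (r : Fin m)
    (x : EuclideanSpace ℝ (Fin m)) : ℝ :=
  fderiv ℝ u x (EuclideanSpace.single r 1)

/-- The function `t ↦ tan (t / l) / l` solves the Riccati equation `φ' = 1 / l ^ 2 + φ ^ 2`. -/
lemma hasDerivAt_tan_div {l t : ℝ} (hl : 0 < l) (ht : |t| ≤ l) :
    HasDerivAt (fun s => Real.tan (s / l) / l) (1 / l ^ 2 + (Real.tan (t / l) / l) ^ 2) t := by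
  have hle : |t / l| ≤ 1 := by
    rw [abs_div, abs_of_pos hl]
    exact (div_le_one hl).2 ht
  have hcos : 0 < Real.cos (t / l) := Real.cos_pos_of_le_one hle
  have h := ((Real.hasDerivAt_tan hcos.ne').comp t ((hasDerivAt_id t).div_const l)).div_const l
  refine h.congr_deriv ?_
  rw [Real.tan_eq_sin_div_cos]
  have h1 := Real.sin_sq_add_cos_sq (t / l)
  field_simp
  linarith

/-- A Poincaré inequality on the box `∏ [-l i, l i]` for functions vanishing on its boundary. -/
lemma sum_inv_sq_mul_integral_sq_le {m : ℕ} {l : Fin (m + 1) → ℝ} (hl : ∀ i, 0 < l i)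
    {v : (Fin (m + 1) → ℝ) → ℝ} {v' : (Fin (m + 1) → ℝ) → (Fin (m + 1) → ℝ) →L[ℝ] ℝ}
    (hv : ContinuousOn v (Icc (-l) l)) (hv' : ContinuousOn v' (Icc (-l) l))
    (hd : ∀ x ∈ pi univ (fun i => Ioo (-l i) (l i)), HasFDerivAt v (v' x) x)
    (h0 : ∀ x ∈ Icc (-l) l, (∃ i, |x i| = l i) → v x = 0) :
    (∑ i, 1 / l i ^ 2) * ∫ x in Icc (-l) l, v x ^ 2 ≤
      ∑ i, ∫ x in Icc (-l) l, (v' x (Pi.single i 1)) ^ 2 := by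
  have habs : ∀ x ∈ Icc (-l) l, ∀ i, |x i| ≤ l i := fun x hx i => abs_le.2 ⟨hx.1 i, hx.2 i⟩
  have hle : -l ≤ l := fun i => by
    have := hl i
    simp only [Pi.neg_apply]
    linarith
  set φ : Fin (m + 1) → ℝ → ℝ := fun i s => Real.tan (s / l i) / l i with hφ
  have hφc : ∀ i, ContinuousOn (fun x : Fin (m + 1) → ℝ => φ i (x i)) (Icc (-l) l) := fun i x hx =>
    (ContinuousAt.comp (f := fun y : Fin (m + 1) → ℝ => y i) (g := φ i)
      (hasDerivAt_tan_div (hl i) (habs x hx i)).continuousAt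
      (continuous_apply i).continuousAt).continuousWithinAt
  have hvi : ∀ i, ContinuousOn (fun x => v' x (Pi.single i 1)) (Icc (-l) l) := fun i =>
    hv'.clm_apply continuousOn_const
  have hvi2 : ∀ i, ContinuousOn (fun x => (v' x (Pi.single i 1)) ^ 2) (Icc (-l) l) := fun i =>
    (hvi i).pow 2
  set f' : Fin (m + 1) → (Fin (m + 1) → ℝ) → (Fin (m + 1) → ℝ) →L[ℝ] ℝ := fun i x =>
    φ i (x i) • ((2 * v x) • v' x) +
      (v x ^ 2) • ((1 / l i ^ 2 + φ i (x i) ^ 2) • ContinuousLinearMap.proj i) with hf'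
  have hf'e : ∀ i x, f' i x (Pi.single i 1) =
      φ i (x i) * (2 * v x * v' x (Pi.single i 1)) + v x ^ 2 * (1 / l i ^ 2 + φ i (x i) ^ 2) := by
    intro i x
    simp [hf']
  have hdivc : ∀ i, ContinuousOn (fun x => f' i x (Pi.single i 1)) (Icc (-l) l) := by
    intro i
    simp only [hf'e]
    exact ((hφc i).mul ((continuousOn_const.mul hv).mul (hvi i))).add
      ((hv.pow 2).mul (continuousOn_const.add ((hφc i).pow 2)))
  have hint : ∀ {g : (Fin (m + 1) → ℝ) → ℝ}, ContinuousOn g (Icc (-l) l) →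
      IntegrableOn g (Icc (-l) l) := fun hg => hg.integrableOn_compact isCompact_Icc
  have hdiv : ∫ x in Icc (-l) l, ∑ i, f' i x (Pi.single i 1) = 0 := by
    rw [integral_divergence_of_hasFDerivAt_off_countable' (-l) l hle
      (fun i x => φ i (x i) * v x ^ 2) f' ∅ countable_empty
      (fun i => (hφc i).mul (hv.pow 2)) ?_ (hint (continuousOn_finsetSum _ fun i _ => hdivc i))]
    · refine Finset.sum_eq_zero fun i _ => ?_
      have hface : ∀ c, |c| = l i →
          ∫ y in Icc ((-l) ∘ i.succAbove) (l ∘ i.succAbove),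
            φ i ((i.insertNth c y : Fin (m + 1) → ℝ) i) * v (i.insertNth c y) ^ 2 = 0 := by
        intro c hc
        refine setIntegral_eq_zero_of_forall_eq_zero fun y hy => ?_
        have hmem : (i.insertNth c y : Fin (m + 1) → ℝ) ∈ Icc (-l) l := by
          rw [Fin.insertNth_mem_Icc]
          exact ⟨abs_le.1 hc.le, hy⟩
        rw [h0 _ hmem ⟨i, by simpa using hc⟩]
        simp
      rw [hface _ (abs_of_pos (hl i)), hface _ (by simp [abs_of_pos (hl i)]), sub_zero]
    · rintro x ⟨hx, -⟩ i
      have hxi : |x i| ≤ l i := abs_le.2 ⟨(hx i (mem_univ i)).1.le, (hx i (mem_univ i)).2.le⟩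
      have h1 : HasFDerivAt (fun x : Fin (m + 1) → ℝ => φ i (x i))
          ((1 / l i ^ 2 + φ i (x i) ^ 2) • ContinuousLinearMap.proj i) x :=
        HasDerivAt.comp_hasFDerivAt (f := fun y : Fin (m + 1) → ℝ => y i) (h₂ := φ i) x
          (hasDerivAt_tan_div (hl i) hxi)
          (ContinuousLinearMap.proj (R := ℝ) (φ := fun _ : Fin (m + 1) => ℝ) i).hasFDerivAt
      have h2 : HasFDerivAt (fun x => v x ^ 2) ((2 * v x) • v' x) x := by
        simpa using (hd x hx).pow 2
      exact h1.mul h2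
  rw [integral_finsetSum _ fun i _ => hint (hdivc i)] at hdiv
  suffices h : ∀ i, 1 / l i ^ 2 * ∫ x in Icc (-l) l, v x ^ 2 ≤
      (∫ x in Icc (-l) l, (v' x (Pi.single i 1)) ^ 2) +
        ∫ x in Icc (-l) l, f' i x (Pi.single i 1) by
    rw [Finset.sum_mul]
    refine (Finset.sum_le_sum fun i _ => h i).trans_eq ?_
    rw [Finset.sum_add_distrib, hdiv, add_zero]
  intro i
  rw [← integral_const_mul, ← integral_add (hint (hvi2 i)) (hint (hdivc i))]
  refine integral_mono (hint (continuousOn_const.mul (hv.pow 2)))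
    ((hint (hvi2 i)).add (hint (hdivc i))) fun x => ?_
  simp only [hf'e]
  nlinarith [sq_nonneg (v' x (Pi.single i 1) + φ i (x i) * v x)]

/-- The Rayleigh quotient of a real symmetric matrix is bounded by its largest eigenvalue. -/
lemma dotProduct_mulVec_le_of_eigenvalue_le {ι : Type*} [Fintype ι] [DecidableEq ι]
    {S : Matrix ι ι ℝ} (hS : S.IsSymm) {c : ℝ}
    (hc : ∀ (μ : ℝ) (v : ι → ℝ), v ≠ 0 → S *ᵥ v = μ • v → μ ≤ c) (a : ι → ℝ) :
    a ⬝ᵥ (S *ᵥ a) ≤ c * (a ⬝ᵥ a) := by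
  have hH : (c • (1 : Matrix ι ι ℝ) - S).IsHermitian := by
    rw [Matrix.IsHermitian, conjTranspose_eq_transpose_of_trivial]
    simp [hS.eq]
  have hpos : (c • (1 : Matrix ι ι ℝ) - S).PosSemidef := by
    rw [hH.posSemidef_iff_eigenvalues_nonneg]
    intro i
    have h := hH.mulVec_eigenvectorBasis i
    rw [sub_mulVec, smul_mulVec, one_mulVec, sub_eq_iff_eq_add] at h
    have hv : (hH.eigenvectorBasis i : ι → ℝ) ≠ 0 := fun h0 =>
      hH.eigenvectorBasis.toBasis.ne_zero i (by ext j; simpa using congrFun h0 j)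
    have := hc (c - hH.eigenvalues i) _ hv (by rw [sub_smul, h]; simp)
    simpa using this
  have h := hpos.dotProduct_mulVec_nonneg a
  simp only [star_trivial, sub_mulVec, smul_mulVec, one_mulVec, dotProduct_sub,
    dotProduct_smul, smul_eq_mul] at h
  linarith

lemma dotProduct_kronecker_diagonal_mulVec {ι κ : Type*} [Fintype ι] [Fintype κ] [DecidableEq κ]
    (S : Matrix ι ι ℝ) (γ : κ → ℝ) (a : ι × κ → ℝ) :
    a ⬝ᵥ ((S ⊗ₖ diagonal γ) *ᵥ a) =
      ∑ k, γ k * ((fun i => a (i, k)) ⬝ᵥ (S *ᵥ fun i => a (i, k))) := by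
  simp only [dotProduct, mulVec, Fintype.sum_prod_type, kroneckerMap_apply, diagonal_apply,
    mul_ite, mul_zero, ite_mul, zero_mul, Finset.sum_ite_eq, Finset.mem_univ, if_true,
    Finset.mul_sum]
  rw [Finset.sum_comm]
  refine Finset.sum_congr rfl fun k _ => Finset.sum_congr rfl fun i _ =>
    Finset.sum_congr rfl fun j _ => ?_
  ring

/-- The quadratic form of `S ⊗ diag γ` when the eigenvalues of `S` are at most `c ≤ 0` and
the entries of `γ` are at least `g ≥ 0`. -/
lemma dotProduct_kronecker_diagonal_mulVec_le {ι κ : Type*} [Fintype ι] [DecidableEq ι]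
    [Fintype κ] [DecidableEq κ] {S : Matrix ι ι ℝ} (hS : S.IsSymm) {c : ℝ} (hc0 : c ≤ 0)
    (hc : ∀ (μ : ℝ) (v : ι → ℝ), v ≠ 0 → S *ᵥ v = μ • v → μ ≤ c)
    {γ : κ → ℝ} {g : ℝ} (hg : 0 ≤ g) (hγ : ∀ k, g ≤ γ k) (a : ι × κ → ℝ) :
    a ⬝ᵥ ((S ⊗ₖ diagonal γ) *ᵥ a) ≤ g * c * ∑ j, a j ^ 2 := by
  rw [dotProduct_kronecker_diagonal_mulVec, Fintype.sum_prod_type_right, Finset.mul_sum]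
  refine Finset.sum_le_sum fun k _ => ?_
  have hsq : (fun i => a (i, k)) ⬝ᵥ (fun i => a (i, k)) = ∑ i, a (i, k) ^ 2 := by
    simp [dotProduct, sq]
  have h := dotProduct_mulVec_le_of_eigenvalue_le hS hc fun i => a (i, k)
  rw [hsq] at h
  have hs : 0 ≤ ∑ i, a (i, k) ^ 2 := Finset.sum_nonneg fun i _ => sq_nonneg _
  calc γ k * _ ≤ γ k * (c * ∑ i, a (i, k) ^ 2) :=
        mul_le_mul_of_nonneg_left h (hg.trans (hγ k))
    _ ≤ g * (c * ∑ i, a (i, k) ^ 2) :=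
        mul_le_mul_of_nonpos_right (hγ k) (mul_nonpos_of_nonpos_of_nonneg hc0 hs)
    _ = _ := by ring

lemma isOpen_cube {m : ℕ} (l : Fin m → ℝ) :
    IsOpen {x : EuclideanSpace ℝ (Fin m) | ∀ r, |x r| < l r} := by
  simp only [ofPred_forall]
  exact isOpen_iInter_of_finite fun r => isOpen_lt (by fun_prop) continuous_const

lemma cube_eq_preimage {m : ℕ} (l : Fin m → ℝ) :
    {x : EuclideanSpace ℝ (Fin m) | ∀ r, |x r| < l r} =
      PiLp.continuousLinearEquiv 2 ℝ (fun _ : Fin m => ℝ) ⁻¹'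
        pi univ fun r => Ioo (-l r) (l r) := by
  ext x
  simp [abs_lt]

lemma closure_cube {m : ℕ} {l : Fin m → ℝ} (hl : ∀ r, 0 < l r) :
    closure {x : EuclideanSpace ℝ (Fin m) | ∀ r, |x r| < l r} =
      PiLp.continuousLinearEquiv 2 ℝ (fun _ : Fin m => ℝ) ⁻¹' Icc (-l) l := by
  rw [cube_eq_preimage, ← ContinuousLinearEquiv.coe_toHomeomorph, ← Homeomorph.preimage_closure,
    closure_pi_set]
  simp_rw [fun r => closure_Ioo (neg_lt_self (hl r)).ne]
  rw [pi_univ_Icc]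
  rfl

lemma isCompact_closure_cube {m : ℕ} {l : Fin m → ℝ} (hl : ∀ r, 0 < l r) :
    IsCompact (closure {x : EuclideanSpace ℝ (Fin m) | ∀ r, |x r| < l r}) := by
  rw [closure_cube hl, ← ContinuousLinearEquiv.coe_toHomeomorph, Homeomorph.isCompact_preimage]
  exact isCompact_Icc

lemma uniqueDiffOn_closure_cube {m : ℕ} {l : Fin m → ℝ} (hl : ∀ r, 0 < l r) :
    UniqueDiffOn ℝ (closure {x : EuclideanSpace ℝ (Fin m) | ∀ r, |x r| < l r}) := by
  refine uniqueDiffOn_convex ?_ ⟨0, interior_mono subset_closure ?_⟩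
  · rw [closure_cube hl]
    exact (convex_Icc (-l) l).linear_preimage
      (PiLp.continuousLinearEquiv 2 ℝ (fun _ : Fin m => ℝ)).toLinearEquiv.toLinearMap
  · rw [(isOpen_cube l).interior_eq]
    simpa using hl

lemma hasFDerivAt_of_contDiffOn_closure {E : Type*} [NormedAddCommGroup E] [NormedSpace ℝ E]
    {s : Set E} (hs : IsOpen s) {u : E → ℝ} (hu : ContDiffOn ℝ 1 u (closure s)) {x : E}
    (hx : x ∈ s) : HasFDerivAt u (fderivWithin ℝ u (closure s) x) x :=
  ((hu.differentiableOn one_ne_zero) x (subset_closure hx)).hasFDerivWithinAt.hasFDerivAt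
    (Filter.mem_of_superset (hs.mem_nhds hx) subset_closure)

lemma integrableOn_par_mul_par {m : ℕ} {l : Fin m → ℝ} (hl : ∀ r, 0 < l r)
    {u w : EuclideanSpace ℝ (Fin m) → ℝ}
    (hu : ContDiffOn ℝ 1 u (closure {x | ∀ r, |x r| < l r}))
    (hw : ContDiffOn ℝ 1 w (closure {x | ∀ r, |x r| < l r})) (r : Fin m) :
    IntegrableOn (fun x => par u r x * par w r x) {x | ∀ r, |x r| < l r} := by
  have hc : ∀ {u : EuclideanSpace ℝ (Fin m) → ℝ},
      ContDiffOn ℝ 1 u (closure {x | ∀ r, |x r| < l r}) →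
      ContinuousOn (fun x => fderivWithin ℝ u (closure {x | ∀ r, |x r| < l r}) x
        (EuclideanSpace.single r 1)) (closure {x | ∀ r, |x r| < l r}) := fun hu =>
    (hu.continuousOn_fderivWithin (uniqueDiffOn_closure_cube hl) le_rfl).clm_apply
      continuousOn_const
  refine ((((hc hu).mul (hc hw)).integrableOn_compact (isCompact_closure_cube hl)).mono_set
    subset_closure).congr_fun (fun x hx => ?_) (isOpen_cube l).measurableSet
  simp only [par]
  rw [(hasFDerivAt_of_contDiffOn_closure (isOpen_cube l) hu hx).fderiv,
    (hasFDerivAt_of_contDiffOn_closure (isOpen_cube l) hw hx).fderiv]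
  rfl

lemma setIntegral_cube {m : ℕ} (l : Fin m → ℝ) (g : EuclideanSpace ℝ (Fin m) → ℝ) :
    ∫ x in {x : EuclideanSpace ℝ (Fin m) | ∀ r, |x r| < l r}, g x =
      ∫ y in Icc (-l) l, g (WithLp.toLp 2 y) := by
  rw [cube_eq_preimage, volume_pi, ← setIntegral_congr_set Measure.univ_pi_Ioo_ae_eq_Icc,
    ← volume_pi, ← (PiLp.volume_preserving_ofLp (Fin m)).setIntegral_preimage_emb
      (MeasurableEquiv.toLp 2 (Fin m → ℝ)).symm.measurableEmbedding]
  rfl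

/-- The Poincaré inequality on the cube `∏ (-l r, l r)`. -/
lemma poincare_cube {m : ℕ} {l : Fin (m + 1) → ℝ} (hl : ∀ r, 0 < l r)
    {u : EuclideanSpace ℝ (Fin (m + 1)) → ℝ}
    (hu : ContDiffOn ℝ 1 u (closure {x | ∀ r, |x r| < l r}))
    (hu0 : ∀ x ∈ frontier {x : EuclideanSpace ℝ (Fin (m + 1)) | ∀ r, |x r| < l r}, u x = 0) :
    (∑ r, 1 / l r ^ 2) * ∫ x in {x | ∀ r, |x r| < l r}, u x ^ 2 ≤
      ∑ r, ∫ x in {x | ∀ r, |x r| < l r}, par u r x ^ 2 := by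
  set Ω := {x : EuclideanSpace ℝ (Fin (m + 1)) | ∀ r, |x r| < l r} with hΩ
  obtain ⟨ψ, hψ⟩ : ∃ ψ : (Fin (m + 1) → ℝ) ≃L[ℝ] EuclideanSpace ℝ (Fin (m + 1)),
      ∀ y, ψ y = WithLp.toLp 2 y :=
    ⟨(PiLp.continuousLinearEquiv 2 ℝ fun _ => ℝ).symm, fun _ => rfl⟩
  have hmaps : MapsTo ψ (Icc (-l) l) (closure Ω) := fun y hy => by
    rw [closure_cube hl, hψ]
    exact hy
  have hcont : ContinuousOn (fun y => (fderivWithin ℝ u (closure Ω) (ψ y)).comp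
      (ψ : (Fin (m + 1) → ℝ) →L[ℝ] EuclideanSpace ℝ (Fin (m + 1)))) (Icc (-l) l) :=
    (ContinuousLinearMap.precomp ℝ
      (ψ : (Fin (m + 1) → ℝ) →L[ℝ] EuclideanSpace ℝ (Fin (m + 1)))).continuous.comp_continuousOn
      ((hu.continuousOn_fderivWithin (uniqueDiffOn_closure_cube hl) le_rfl).comp
        ψ.continuous.continuousOn hmaps)
  have key := sum_inv_sq_mul_integral_sq_le hl (v := fun y => u (ψ y))
    (v' := fun y => (fderivWithin ℝ u (closure Ω) (ψ y)).comp (ψ : _ →L[ℝ] _))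
    (hu.continuousOn.comp ψ.continuous.continuousOn hmaps)
    hcont
    (fun y hy => (hasFDerivAt_of_contDiffOn_closure (isOpen_cube l) hu
      (by simpa [hψ, abs_lt] using hy)).comp y ψ.hasFDerivAt)
    (by
      rintro y hy ⟨i, hi⟩
      refine hu0 _ ?_
      rw [(isOpen_cube l).frontier_eq]
      exact ⟨hmaps hy, fun h => (h i).ne (by simpa [hψ] using hi)⟩)
  have hval : ∫ x in Ω, u x ^ 2 = ∫ y in Icc (-l) l, u (ψ y) ^ 2 := by
    simp only [hΩ, setIntegral_cube, hψ]
  rw [hval]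
  refine key.trans_eq (Finset.sum_congr rfl fun r _ => ?_)
  have hcongr : ∫ x in Ω, par u r x ^ 2 =
      ∫ x in Ω, (fderivWithin ℝ u (closure Ω) x (EuclideanSpace.single r 1)) ^ 2 :=
    setIntegral_congr_fun (isOpen_cube l).measurableSet fun x hx => by
      simp only [par, (hasFDerivAt_of_contDiffOn_closure (isOpen_cube l) hu hx).fderiv]
      rfl
  rw [hcongr, setIntegral_cube]
  simp only [ContinuousLinearMap.comp_apply, ContinuousLinearEquiv.coe_coe, hψ,
    PiLp.toLp_single]

/-- bound for the spatial diffusion coupling term `V₆`: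
combining the Kronecker quadratic-form bound with the cube Poincaré inequality,
for a `C¹` field `e` on the closed cube vanishing on the boundary, a symmetric
`S` with `λ_max(S) ≤ 0` and `Γ = diag γ` with `γ_k > 0`,
`∑_r ∫ (∂e/∂x_r)ᵀ(S ⊗ Γ)(∂e/∂x_r) ≤
  (min_k γ_k)·λ_max(S)·(∑_r 1/l_r²)·∫ ‖e‖²`. -/
theorem spatial_coupling_bound (m n N : ℕ)
    (l : Fin (m + 1) → ℝ) (hl : ∀ r, 0 < l r)
    (Ω : Set (EuclideanSpace ℝ (Fin (m + 1))))
    (hΩ : Ω = {x : EuclideanSpace ℝ (Fin (m + 1)) | ∀ r, |x r| < l r})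
    (e : EuclideanSpace ℝ (Fin (m + 1)) → Fin (N + 1) × Fin (n + 1) → ℝ)
    (he : ContDiffOn ℝ 1 e (closure Ω))
    (he0 : ∀ x ∈ frontier Ω, e x = 0)
    (S : Matrix (Fin (N + 1)) (Fin (N + 1)) ℝ) (hS : S.IsSymm)
    (lmax : ℝ)
    (hlmax : IsGreatest {μ : ℝ | ∃ v : Fin (N + 1) → ℝ, v ≠ 0 ∧ S *ᵥ v = μ • v} lmax)
    (hlmax0 : lmax ≤ 0)
    (γ : Fin (n + 1) → ℝ) (hγ : ∀ k, 0 < γ k) :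
    (∑ r, ∫ x in Ω, (fun j => par (fun y => e y j) r x) ⬝ᵥ
        ((S ⊗ₖ Matrix.diagonal γ) *ᵥ (fun j => par (fun y => e y j) r x))) ≤
      (Finset.univ.inf' Finset.univ_nonempty γ) * lmax * (∑ r, 1 / (l r) ^ 2) *
        ∫ x in Ω, ∑ j, (e x j) ^ 2 := by
  subst hΩ
  set Ω := {x : EuclideanSpace ℝ (Fin (m + 1)) | ∀ r, |x r| < l r} with hΩ
  set g := Finset.univ.inf' Finset.univ_nonempty γ with hg
  have hg0 : 0 ≤ g := Finset.le_inf' _ _ fun k _ => (hγ k).le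
  have hej : ∀ j, ContDiffOn ℝ 1 (fun y => e y j) (closure Ω) := contDiffOn_pi.1 he
  have hpar := fun i j r => integrableOn_par_mul_par hl (hej i) (hej j) r
  have hsq : ∀ j r, IntegrableOn (fun x => par (fun y => e y j) r x ^ 2) Ω := fun j r => by
    simpa only [sq] using hpar j j r
  have hesq : ∀ j, IntegrableOn (fun x => e x j ^ 2) Ω := fun j =>
    (((hej j).continuousOn.pow 2).integrableOn_compact (isCompact_closure_cube hl)).mono_set
      subset_closure
  have hquad : ∀ r, IntegrableOn (fun x => (fun j => par (fun y => e y j) r x) ⬝ᵥ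
      ((S ⊗ₖ Matrix.diagonal γ) *ᵥ (fun j => par (fun y => e y j) r x))) Ω := by
    intro r
    simp only [dotProduct, mulVec, Finset.mul_sum]
    refine integrable_finsetSum _ fun i _ => integrable_finsetSum _ fun j _ => ?_
    simpa only [mul_left_comm] using (hpar i j r).const_mul ((S ⊗ₖ Matrix.diagonal γ) i j)
  calc _ ≤ ∑ r, ∫ x in Ω, g * lmax * ∑ j, par (fun y => e y j) r x ^ 2 := by
        refine Finset.sum_le_sum fun r _ => integral_mono (hquad r)
          ((integrable_finsetSum _ fun j _ => hsq j r).const_mul _) fun x => ?_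
        exact dotProduct_kronecker_diagonal_mulVec_le hS hlmax0
          (fun μ v hv h => hlmax.2 ⟨v, hv, h⟩) hg0
          (fun k => Finset.inf'_le _ (Finset.mem_univ k)) _
    _ = g * lmax * ∑ j, ∑ r, ∫ x in Ω, par (fun y => e y j) r x ^ 2 := by
        rw [Finset.sum_comm, Finset.mul_sum]
        refine Finset.sum_congr rfl fun r _ => ?_
        rw [integral_const_mul, integral_finsetSum _ fun j _ => hsq j r]
    _ ≤ g * lmax * ∑ j, (∑ r, 1 / l r ^ 2) * ∫ x in Ω, e x j ^ 2 :=
        mul_le_mul_of_nonpos_left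
          (Finset.sum_le_sum fun j _ => poincare_cube hl (hej j) fun x hx => by
            simpa using congrFun (he0 x hx) j)
          (mul_nonpos_of_nonneg_of_nonpos hg0 hlmax0)
    _ = _ := by
        rw [← Finset.mul_sum, integral_finsetSum _ fun j _ => hesq j, mul_assoc (g * lmax)]
end
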